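/- arXiv:2605.19449 — 7 statements merged into one kernel-verified Lean document; each statement's English description precedes it below -/
import Mathlib

section
/- There exists a real constant α > 0 such that for every non-negative integer n, the number of additive 2-bases for n satisfies |Γ(n)| ≥ α · 2^(n+1). -/
open Pointwise

/-- Among the subsets of `S`, those containing none of `m` given disjoint pairs
have density at most `(3/4)^m`. -/
lemma card_powerset_filter_avoid_pairs (a b : ℕ → ℕ) (m : ℕ) :
    ∀ S : Finset ℕ, (∀ i < m, a i ∈ S ∧ b i ∈ S) →
      (∀ i < m, ∀ j < m, a i ≠ b j ∧ (i ≠ j → a i ≠ a j ∧ b i ≠ b j)) →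
      (S.powerset.filter (fun X => ∀ i < m, ¬ (a i ∈ X ∧ b i ∈ X))).card * 4 ^ m
        ≤ 3 ^ m * 2 ^ S.card := by
  induction m with
  | zero => intro S _ _; simp
  | succ m ih =>
    intro S hS hd
    set T := (S.erase (a m)).erase (b m) with hT
    have hab : a m ≠ b m := (hd m (by omega) m (by omega)).1
    have hcard : S.card = T.card + 2 := by
      have h1 := Finset.card_erase_add_one (hS m (by omega)).1
      have h2 := Finset.card_erase_add_one
        (Finset.mem_erase.2 ⟨hab.symm, (hS m (by omega)).2⟩)
      rw [← hT] at h2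
      omega
    have key := ih T (fun i hi => by
        have h1 := hS i (by omega)
        have h2 := (hd i (by omega) m (by omega)).1
        have h3 := (hd m (by omega) i (by omega)).1
        have h4 := (hd i (by omega) m (by omega)).2 (by omega)
        simp only [hT, Finset.mem_erase]
        exact ⟨⟨h2, h4.1, h1.1⟩, h4.2, h3.symm, h1.2⟩)
      (fun i hi j hj => hd i (by omega) j (by omega))
    have hle : (S.powerset.filter (fun X => ∀ i < m + 1, ¬ (a i ∈ X ∧ b i ∈ X))).card ≤
        ((({(False, False), (True, False), (False, True)} : Finset (Prop × Prop))) ×ˢ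
          (T.powerset.filter (fun X => ∀ i < m, ¬ (a i ∈ X ∧ b i ∈ X)))).card := by
      apply Finset.card_le_card_of_injOn
        (fun X => ((a m ∈ X, b m ∈ X), (X.erase (a m)).erase (b m)))
      · intro X hX
        simp only [Finset.coe_filter, Finset.mem_powerset, Set.mem_ofPred_eq] at hX
        have hm := hX.2 m (by omega)
        simp only [Finset.coe_product, Set.mem_prod, Finset.mem_coe, Finset.mem_filter,
          Finset.mem_powerset]
        refine ⟨?_, Finset.erase_subset_erase _ (Finset.erase_subset_erase _ hX.1), ?_⟩
        · by_cases h1 : a m ∈ X <;> by_cases h2 : b m ∈ X <;> simp_all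
        · intro i hi h
          exact hX.2 i (by omega) ⟨Finset.mem_of_mem_erase (Finset.mem_of_mem_erase h.1),
            Finset.mem_of_mem_erase (Finset.mem_of_mem_erase h.2)⟩
      · intro X _ Y _ h
        simp only [Prod.mk.injEq, eq_iff_iff] at h
        ext x
        by_cases h1 : x = a m
        · rw [h1]; exact h.1.1
        by_cases h2 : x = b m
        · rw [h2]; exact h.1.2
        have := congrArg (x ∈ ·) h.2
        simpa [h1, h2] using this
    rw [Finset.card_product] at hle
    have h3 : (({(False, False), (True, False), (False, True)} : Finset (Prop × Prop))).card ≤ 3 :=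
      Finset.card_le_three
    have h4 := hle.trans (Nat.mul_le_mul_right _ h3)
    rw [hcard]
    calc _ ≤ _ := Nat.mul_le_mul_right (4 ^ (m + 1)) h4
      _ = 12 * (_ * 4 ^ m) := by ring
      _ ≤ 12 * _ := Nat.mul_le_mul_left 12 key
      _ = _ := by ring

lemma sum_three_quarters_pow_half_le (J : ℕ) :
    ∑ j ∈ Finset.range J, (3 / 4 : ℝ) ^ (j / 2) ≤ 8 := by
  have h : ∀ M : ℕ, ∑ j ∈ Finset.range (2 * M), (3 / 4 : ℝ) ^ (j / 2)
      = 8 * (1 - (3 / 4) ^ M) := by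
    intro M
    induction M with
    | zero => simp
    | succ M ih =>
      rw [show 2 * (M + 1) = 2 * M + 1 + 1 by ring, Finset.sum_range_succ,
        Finset.sum_range_succ, ih, show (2 * M + 1) / 2 = M by omega,
        show 2 * M / 2 = M by omega]
      ring
  calc _ ≤ ∑ j ∈ Finset.range (2 * J), (3 / 4 : ℝ) ^ (j / 2) :=
        Finset.sum_le_sum_of_subset_of_nonneg
          (Finset.range_subset_range.2 (by omega)) (fun _ _ _ => by positivity)
    _ ≤ 8 := by
      rw [h]
      have : (0 : ℝ) ≤ (3 / 4) ^ J := by positivity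
      linarith

/-- The subsets `Y` of `[4, N + 3]` for which `j + 7` is not a sum of two elements of
`{0, 1, 2, 3} ∪ Y` have density at most `(3/4)^⌊j/2⌋ / 16`. -/
lemma card_powerset_filter_not_mem_add (N j : ℕ) (hj : j < N - 3) :
    (((Finset.Icc 4 (N + 3)).powerset.filter
      (fun Y => j + 7 ∉ (Finset.range 4 ∪ Y) + (Finset.range 4 ∪ Y))).card : ℝ)
      ≤ 2 ^ N / 16 * (3 / 4) ^ (j / 2) := by
  set T := Finset.Icc 4 (N + 3) \ Finset.Icc (j + 4) (j + 7) with hT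
  have hcard : T.card + 4 = N := by
    rw [hT, Finset.card_sdiff_of_subset (Finset.Icc_subset_Icc (by omega) (by omega))]
    simp only [Nat.card_Icc]
    omega
  have h1 := card_powerset_filter_avoid_pairs (fun i => 4 + i) (fun i => j + 3 - i) (j / 2) T
    (by intro i hi; simp only [hT, Finset.mem_sdiff, Finset.mem_Icc]; omega)
    (by intro i hi k hk; omega)
  have hsub : (Finset.Icc 4 (N + 3)).powerset.filter
      (fun Y => j + 7 ∉ (Finset.range 4 ∪ Y) + (Finset.range 4 ∪ Y)) ⊆
      T.powerset.filter (fun X => ∀ i < j / 2, ¬ (4 + i ∈ X ∧ j + 3 - i ∈ X)) := by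
    intro Y hY
    simp only [Finset.mem_filter, Finset.mem_powerset] at hY ⊢
    obtain ⟨hY1, hY2⟩ := hY
    refine ⟨fun x hx => ?_, fun i hi h => ?_⟩
    · refine Finset.mem_sdiff.2 ⟨hY1 hx, fun hx2 => hY2 ?_⟩
      rw [Finset.mem_Icc] at hx2
      exact Finset.mem_add.2 ⟨j + 7 - x,
        Finset.mem_union_left _ (Finset.mem_range.2 (by omega)),
        x, Finset.mem_union_right _ hx, by omega⟩
    · exact hY2 (Finset.mem_add.2 ⟨_, Finset.mem_union_right _ h.1,
        _, Finset.mem_union_right _ h.2, by omega⟩)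
  have h2 := (Nat.mul_le_mul_right (4 ^ (j / 2)) (Finset.card_le_card hsub)).trans h1
  have h3 : (((Finset.Icc 4 (N + 3)).powerset.filter
      (fun Y => j + 7 ∉ (Finset.range 4 ∪ Y) + (Finset.range 4 ∪ Y))).card : ℝ) * 4 ^ (j / 2)
      ≤ 3 ^ (j / 2) * 2 ^ T.card := by exact_mod_cast h2
  have h4 : (2 : ℝ) ^ N / 16 = 2 ^ T.card := by
    rw [← hcard, pow_add]
    norm_num
  rw [h4, div_pow, ← mul_div_assoc, le_div_iff₀ (by positivity), mul_comm (2 ^ T.card)]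
  exact h3

lemma card_additive_bases_ge (N : ℕ) :
    (2 : ℝ) ^ N / 2 ≤ (((Finset.range (N + 3 + 1)).powerset.filter
      (fun X : Finset ℕ => Finset.range (N + 3 + 1) ⊆ X + X)).card : ℝ) := by
  set G := (Finset.range (N + 3 + 1)).powerset.filter
      (fun X : Finset ℕ => Finset.range (N + 3 + 1) ⊆ X + X) with hG
  set S := Finset.Icc 4 (N + 3) with hS
  set B : ℕ → Finset (Finset ℕ) := fun j => S.powerset.filter
      (fun Y => j + 7 ∉ (Finset.range 4 ∪ Y) + (Finset.range 4 ∪ Y)) with hB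
  set U := (Finset.range (N - 3)).biUnion B with hU
  have hmap : (S.powerset \ U).card ≤ G.card := by
    apply Finset.card_le_card_of_injOn (fun Y => Finset.range 4 ∪ Y)
    · intro Y hY
      simp only [Finset.coe_sdiff, Set.mem_sdiff, Finset.mem_coe, hU, hB, Finset.mem_biUnion,
        Finset.mem_filter, Finset.mem_powerset, Finset.mem_range, not_exists, not_and,
        not_not] at hY
      simp only [hG, Finset.mem_coe, Finset.mem_filter, Finset.mem_powerset]
      constructor
      · intro x hx
        rcases Finset.mem_union.1 hx with hx | hx
        · rw [Finset.mem_range] at hx ⊢; omega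
        · have := Finset.mem_Icc.1 (hY.1 hx)
          rw [Finset.mem_range]; omega
      · intro k hk
        rw [Finset.mem_range] at hk
        by_cases h : k < 7
        · exact Finset.mem_add.2 ⟨k / 2,
            Finset.mem_union_left _ (Finset.mem_range.2 (by omega)), k - k / 2,
            Finset.mem_union_left _ (Finset.mem_range.2 (by omega)), by omega⟩
        · have := hY.2 (k - 7) (by omega) hY.1
          rwa [show k - 7 + 7 = k by omega] at this
    · intro Y hY Z hZ h
      have hdis : ∀ W ⊆ S, Disjoint (Finset.range 4) W := fun W hW =>
        Finset.disjoint_left.2 fun x hx hxW => by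
          have := Finset.mem_Icc.1 (hW hxW)
          rw [Finset.mem_range] at hx
          omega
      have hY' := Finset.mem_powerset.1 (Finset.mem_sdiff.1 (Finset.mem_coe.1 hY)).1
      have hZ' := Finset.mem_powerset.1 (Finset.mem_sdiff.1 (Finset.mem_coe.1 hZ)).1
      dsimp only at h
      rw [← Finset.union_sdiff_cancel_left (hdis Y hY'), h,
        Finset.union_sdiff_cancel_left (hdis Z hZ')]
  have hUcard : (U.card : ℝ) ≤ 2 ^ N / 2 := by
    calc (U.card : ℝ) ≤ ∑ j ∈ Finset.range (N - 3), ((B j).card : ℝ) := by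
          exact_mod_cast Finset.card_biUnion_le
      _ ≤ ∑ j ∈ Finset.range (N - 3), (2 : ℝ) ^ N / 16 * (3 / 4) ^ (j / 2) :=
          Finset.sum_le_sum fun j hj =>
            card_powerset_filter_not_mem_add N j (Finset.mem_range.1 hj)
      _ = 2 ^ N / 16 * ∑ j ∈ Finset.range (N - 3), (3 / 4 : ℝ) ^ (j / 2) :=
          (Finset.mul_sum _ _ _).symm
      _ ≤ 2 ^ N / 16 * 8 :=
          mul_le_mul_of_nonneg_left (sum_three_quarters_pow_half_le _) (by positivity)
      _ = 2 ^ N / 2 := by ring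
  have hP : S.powerset.card = 2 ^ N := by
    rw [Finset.card_powerset, hS, Nat.card_Icc]
    congr 1
  have hle : S.powerset.card ≤ G.card + U.card :=
    (Nat.sub_le_iff_le_add.1 (Finset.le_card_sdiff U S.powerset)).trans
      (Nat.add_le_add_right hmap _)
  rw [hP] at hle
  have hle' : (2 : ℝ) ^ N ≤ G.card + U.card := by exact_mod_cast hle
  linarith
/-- There exists a real constant `α > 0` such that for every non-negative integer `n`,
the number of additive 2-bases for `n` satisfies `|Γ(n)| ≥ α · 2^(n+1)`. -/
theorem exists_exponential_lower_bound :
    ∃ α : ℝ, 0 < α ∧ ∀ n : ℕ,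
      α * 2 ^ (n + 1) ≤
        (((Finset.range (n + 1)).powerset.filter
            (fun X : Finset ℕ => Finset.range (n + 1) ⊆ X + X)).card : ℝ) := by
  refine ⟨1 / 32, by norm_num, fun n => ?_⟩
  by_cases hn : 3 ≤ n
  · obtain ⟨N, rfl⟩ := Nat.exists_eq_add_of_le' hn
    refine le_trans (le_of_eq ?_) (card_additive_bases_ge N)
    ring
  · have h1 : (1 : ℝ) ≤ (((Finset.range (n + 1)).powerset.filter
        (fun X : Finset ℕ => Finset.range (n + 1) ⊆ X + X)).card : ℝ) := by
      rw [Nat.one_le_cast, Nat.one_le_iff_ne_zero, ← Nat.pos_iff_ne_zero, Finset.card_pos]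
      refine ⟨Finset.range (n + 1), Finset.mem_filter.2 ⟨Finset.mem_powerset_self _, ?_⟩⟩
      intro k hk
      exact Finset.mem_add.2 ⟨0, by simp, k, hk, by simp⟩
    have h2 : (2 : ℝ) ^ (n + 1) ≤ 2 ^ 3 :=
      pow_le_pow_right₀ (by norm_num) (by omega)
    linarith
end

section
/- For every non-negative integer n and every integer k with 0 ≤ k ≤ n + 1, the number of subsets X ⊆ [n]₀ such that k ∉ X + X is at most (3/4)^(k/2 − 1) · 2^(n+1). (Equivalently: if X is a uniformly random subset of [n]₀, then P[k ∉ X + X] ≤ (3/4)^(k/2 − 1), where the exponent k/2 − 1 is a real number.) -/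
open Pointwise

/-- If `{f i, g i}`, `i ∈ I`, are pairwise disjoint two-element subsets of `S`, then at most a
`(3/4)^|I|` proportion of the subsets of `S` contain none of these pairs. -/
theorem card_filter_avoids_pairs_le {ι α : Type*} [DecidableEq ι] [DecidableEq α]
    (f g : ι → α) (I : Finset ι) (S : Finset α)
    (hne : ∀ i ∈ I, f i ≠ g i)
    (hdisj : (I : Set ι).PairwiseDisjoint fun i => ({f i, g i} : Finset α))
    (hsub : ∀ i ∈ I, {f i, g i} ⊆ S) :
    (S.powerset.filter fun X => ∀ i ∈ I, ¬(f i ∈ X ∧ g i ∈ X)).card * 4 ^ I.card ≤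
      3 ^ I.card * 2 ^ S.card := by
  induction I using Finset.induction_on generalizing S with
  | empty => simp
  | insert j I hj ih =>
    set p : Finset α := {f j, g j} with hp
    have hpS : p ⊆ S := hsub j (Finset.mem_insert_self j I)
    have hdj : ∀ i ∈ I, Disjoint {f i, g i} p := fun i hi =>
      hdisj (Finset.mem_coe.2 (Finset.mem_insert_of_mem hi))
        (Finset.mem_coe.2 (Finset.mem_insert_self j I)) (ne_of_mem_of_not_mem hi hj)
    have key := ih (S \ p) (fun i hi => hne i (Finset.mem_insert_of_mem hi))
      (hdisj.subset (by simp))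
      (fun i hi => Finset.subset_sdiff.2 ⟨hsub i (Finset.mem_insert_of_mem hi), hdj i hi⟩)
    set F := (S \ p).powerset.filter fun X => ∀ i ∈ I, ¬(f i ∈ X ∧ g i ∈ X) with hF
    have hcover : (S.powerset.filter fun X => ∀ i ∈ insert j I, ¬(f i ∈ X ∧ g i ∈ X)) ⊆
        F ∪ (F.image (insert (f j)) ∪ F.image (insert (g j))) := by
      intro X hX
      rw [Finset.mem_filter, Finset.mem_powerset] at hX
      obtain ⟨hXS, hX⟩ := hX
      have hXF : X \ p ∈ F := by
        rw [hF, Finset.mem_filter, Finset.mem_powerset]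
        exact ⟨Finset.sdiff_subset_sdiff hXS subset_rfl, fun i hi h =>
          hX i (Finset.mem_insert_of_mem hi)
            ⟨(Finset.mem_sdiff.1 h.1).1, (Finset.mem_sdiff.1 h.2).1⟩⟩
      have hXj := hX j (Finset.mem_insert_self j I)
      simp only [Finset.mem_union, Finset.mem_image]
      by_cases hf : f j ∈ X
      · refine Or.inr (Or.inl ⟨X \ p, hXF, ?_⟩)
        ext x
        simp only [hp, Finset.mem_insert, Finset.mem_sdiff, Finset.mem_singleton]
        grind
      by_cases hg : g j ∈ X
      · refine Or.inr (Or.inr ⟨X \ p, hXF, ?_⟩)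
        ext x
        simp only [hp, Finset.mem_insert, Finset.mem_sdiff, Finset.mem_singleton]
        grind
      · left
        rwa [Finset.sdiff_eq_self_of_disjoint] at hXF
        simp [hp, hf, hg]
    have hcard := (Finset.card_le_card hcover).trans (Finset.card_union_le _ _)
    have hunion := Finset.card_union_le (F.image (insert (f j))) (F.image (insert (g j)))
    have himf : (F.image (insert (f j))).card ≤ F.card := Finset.card_image_le
    have himg : (F.image (insert (g j))).card ≤ F.card := Finset.card_image_le
    have hS : S.card = (S \ p).card + 2 := by
      rw [← Finset.card_sdiff_add_card_eq_card hpS, hp,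
        Finset.card_pair (hne j (Finset.mem_insert_self j I))]
    rw [Finset.card_insert_of_notMem hj, hS]
    calc _ ≤ (3 * F.card) * 4 ^ (I.card + 1) := Nat.mul_le_mul_right _ (by omega)
      _ = 12 * (F.card * 4 ^ I.card) := by ring
      _ ≤ 12 * (3 ^ I.card * 2 ^ (S \ p).card) := Nat.mul_le_mul_left _ key
      _ = _ := by ring

/-- For every `n ≥ 0` and every `k` with `0 ≤ k ≤ n + 1`, the number of subsets
`X ⊆ [n]₀` with `k ∉ X + X` is at most `(3/4)^(k/2 - 1) · 2^(n+1)`,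
where the exponent `k/2 - 1` is real. -/
theorem count_not_generated_le (n k : ℕ) (hk : k ≤ n + 1) :
    (((Finset.range (n + 1)).powerset.filter
        (fun X : Finset ℕ => k ∉ X + X)).card : ℝ) ≤
      (3 / 4 : ℝ) ^ ((k : ℝ) / 2 - 1) * 2 ^ (n + 1) := by
  set m := (k - 1) / 2 with hm
  have hpairs := card_filter_avoids_pairs_le (fun i => i) (fun i => k - i) (Finset.Icc 1 m)
    (Finset.range (n + 1))
    (by intro i hi; rw [Finset.mem_Icc] at hi; omega)
    (by
      intro i hi j hj hij
      simp only [Finset.coe_Icc, Set.mem_Icc] at hi hj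
      simp only [Function.onFun, Finset.disjoint_left, Finset.mem_insert, Finset.mem_singleton]
      omega)
    (by
      intro i hi x hx
      simp only [Finset.mem_Icc, Finset.mem_insert, Finset.mem_singleton, Finset.mem_range] at *
      omega)
  rw [Nat.card_Icc, Nat.add_sub_cancel, Finset.card_range] at hpairs
  have hsubset : ((Finset.range (n + 1)).powerset.filter fun X : Finset ℕ => k ∉ X + X) ⊆
      (Finset.range (n + 1)).powerset.filter
        fun X => ∀ i ∈ Finset.Icc 1 m, ¬(i ∈ X ∧ k - i ∈ X) := by
    refine Finset.monotone_filter_right _ fun X _ hX i hi h => hX ?_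
    rw [Finset.mem_Icc] at hi
    exact Finset.mem_add.2 ⟨i, h.1, k - i, h.2, by omega⟩
  have hnat := (Nat.mul_le_mul_right (4 ^ m) (Finset.card_le_card hsubset)).trans hpairs
  have hexp : (k : ℝ) / 2 - 1 ≤ m := by
    have : (k : ℝ) ≤ 2 * m + 2 := by exact_mod_cast (by omega : k ≤ 2 * m + 2)
    linarith
  calc _ ≤ (3 / 4 : ℝ) ^ m * 2 ^ (n + 1) := by
        rw [div_pow, div_mul_eq_mul_div, le_div_iff₀ (by positivity)]
        exact_mod_cast hnat
    _ ≤ _ := by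
        gcongr
        rw [← Real.rpow_natCast]
        exact Real.rpow_le_rpow_of_exponent_ge (by norm_num) (by norm_num) hexp
end

section
/- For every non-negative integer n, the sum over k ∈ {0,1,…,n} of the number of subsets X ⊆ [n]₀ with k ∉ X + X is at most 10 · 2^(n+1). (Equivalently: if X is a uniformly random subset of [n]₀, then the expected cardinality of [n]₀ \ (X + X) is at most 10.) -/
open Pointwise

/-- Splitting the subsets of `insert a s` satisfying `p` according to whether they contain `a`. -/
theorem card_filter_powerset_insert {α : Type*} [DecidableEq α] {s : Finset α} {a : α}
    (ha : a ∉ s) (p : Finset α → Prop) [DecidablePred p] :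
    ((insert a s).powerset.filter p).card =
      (s.powerset.filter p).card + (s.powerset.filter fun X => p (insert a X)).card := by
  simp only [Finset.card_filter]
  exact Finset.sum_powerset_insert ha _

/-- A proportion of at most `(3 / 4) ^ m` of the subsets of `G` contains none of the `m` disjoint
pairs `{i, k - i}`, `i < m`. -/
theorem four_pow_mul_card_filter_avoiding_le (k m : ℕ) (hm : 2 * m ≤ k + 1) (G : Finset ℕ)
    (hG : ∀ i < m, i ∈ G ∧ k - i ∈ G) :
    4 ^ m * (G.powerset.filter fun X => ∀ i < m, ¬ (i ∈ X ∧ k - i ∈ X)).card ≤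
      3 ^ m * 2 ^ G.card := by
  induction m generalizing G with
  | zero => simp
  | succ m ih =>
    obtain ⟨hmG, hkG⟩ := hG m (by omega)
    have hne : m ≠ k - m := by omega
    set H := (G.erase m).erase (k - m) with hH
    have hkH : k - m ∉ H := by simp [hH]
    have hmH : m ∉ insert (k - m) H := by simp [hH, hne]
    have hGH : G = insert m (insert (k - m) H) := by
      rw [hH, Finset.insert_erase (by simp [hkG, hne.symm]), Finset.insert_erase hmG]
    have hcard : G.card = H.card + 2 := by
      rw [hGH, Finset.card_insert_of_notMem hmH, Finset.card_insert_of_notMem hkH]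
    have hrec := ih (by omega) H fun i hi => by
      have := hG i (by omega)
      simp only [hH, Finset.mem_erase]
      exact ⟨⟨by omega, by omega, this.1⟩, by omega, by omega, this.2⟩
    rw [hcard, hGH, card_filter_powerset_insert hmH, card_filter_powerset_insert hkH,
      card_filter_powerset_insert hkH]
    set c := (H.powerset.filter fun X => ∀ i < m, ¬ (i ∈ X ∧ k - i ∈ X)).card
    have hle (f : Finset ℕ → Finset ℕ) (hf : ∀ X, X ⊆ f X) :
        (H.powerset.filter fun X => ∀ i < m + 1, ¬ (i ∈ f X ∧ k - i ∈ f X)).card ≤ c := by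
      refine Finset.card_le_card (Finset.monotone_filter_right _ fun X _ hX i hi h => ?_)
      exact hX i (by omega) ⟨hf X h.1, hf X h.2⟩
    have h₁ := hle id fun X => subset_rfl
    have h₂ := hle (insert (k - m)) fun X => Finset.subset_insert _ _
    have h₃ := hle (insert m) fun X => Finset.subset_insert _ _
    have h₄ : (H.powerset.filter fun X => ∀ i < m + 1,
        ¬ (i ∈ insert m (insert (k - m) X) ∧ k - i ∈ insert m (insert (k - m) X))).card = 0 := by
      refine Finset.card_eq_zero.2 (Finset.filter_eq_empty_iff.2 fun X _ hX => ?_)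
      exact hX m (by omega) (by simp)
    simp only [id] at h₁
    calc _ ≤ 4 ^ (m + 1) * (3 * c) := by gcongr; omega
      _ = 12 * (4 ^ m * c) := by ring
      _ ≤ 12 * (3 ^ m * 2 ^ H.card) := by gcongr
      _ = _ := by ring

theorem card_filter_notMem_add_self_le {n k : ℕ} (hk : k ≤ n) :
    (((Finset.range (n + 1)).powerset.filter fun X : Finset ℕ => k ∉ X + X).card : ℝ) ≤
      (3 / 4) ^ ((k + 1) / 2) * 2 ^ (n + 1) := by
  set m := (k + 1) / 2 with hm
  have hcount := four_pow_mul_card_filter_avoiding_le k m (by omega) (Finset.range (n + 1))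
    fun i hi => by simp only [Finset.mem_range]; omega
  have hle : ((Finset.range (n + 1)).powerset.filter fun X : Finset ℕ => k ∉ X + X).card ≤
      ((Finset.range (n + 1)).powerset.filter
        fun X => ∀ i < m, ¬ (i ∈ X ∧ k - i ∈ X)).card := by
    refine Finset.card_le_card (Finset.monotone_filter_right _ fun X _ hX i hi h => hX ?_)
    exact Finset.mem_add.2 ⟨i, h.1, k - i, h.2, by omega⟩
  have hcount' := (Nat.mul_le_mul_left (4 ^ m) hle).trans hcount
  rw [Finset.card_range] at hcount'
  rw [div_pow, div_mul_eq_mul_div, le_div_iff₀ (by positivity), mul_comm]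
  exact_mod_cast hcount'

theorem sum_range_two_mul_pow_half (N : ℕ) :
    ∑ k ∈ Finset.range (2 * N), (3 / 4 : ℝ) ^ ((k + 1) / 2) = 7 - 7 * (3 / 4) ^ N := by
  induction N with
  | zero => simp
  | succ N ih =>
    rw [show 2 * (N + 1) = 2 * N + 1 + 1 by ring, Finset.sum_range_succ, Finset.sum_range_succ, ih,
      show (2 * N + 1) / 2 = N by omega, show (2 * N + 1 + 1) / 2 = N + 1 by omega]
    ring

/-- For every `n ≥ 0`, the sum over `k ∈ {0,…,n}` of the number of subsets
`X ⊆ [n]₀` with `k ∉ X + X` is at most `10 · 2^(n+1)`. -/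
theorem expected_missing_le_ten (n : ℕ) :
    ∑ k ∈ Finset.range (n + 1),
        ((Finset.range (n + 1)).powerset.filter
          (fun X : Finset ℕ => k ∉ X + X)).card ≤ 10 * 2 ^ (n + 1) := by
  have hsum : ∑ k ∈ Finset.range (n + 1), (3 / 4 : ℝ) ^ ((k + 1) / 2) ≤ 10 :=
    calc _ ≤ ∑ k ∈ Finset.range (2 * (n + 1)), (3 / 4 : ℝ) ^ ((k + 1) / 2) :=
          Finset.sum_le_sum_of_subset_of_nonneg (Finset.range_mono (by omega))
            fun _ _ _ => by positivity
      _ = 7 - 7 * (3 / 4) ^ (n + 1) := sum_range_two_mul_pow_half _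
      _ ≤ 10 := by linarith [show (0 : ℝ) ≤ (3 / 4) ^ (n + 1) by positivity]
  rify
  calc _ ≤ ∑ k ∈ Finset.range (n + 1), (3 / 4 : ℝ) ^ ((k + 1) / 2) * 2 ^ (n + 1) :=
        Finset.sum_le_sum fun k hk =>
          card_filter_notMem_add_self_le (Nat.lt_succ_iff.1 (Finset.mem_range.1 hk))
    _ ≤ 10 * 2 ^ (n + 1) := by rw [← Finset.sum_mul]; gcongr
end

section
/- For every non-negative integer n, the number of additive 2-bases for n satisfies |Γ(n)| ≥ 2^n / (n+1)^20. -/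
open Pointwise

/-- If the nonempty initial segment `[0, K)` is contained in `X` and `X` meets `(m - K, m]`, then
`m ∈ X + X`. -/
lemma mem_add_self_of_not_disjoint {X : Finset ℕ} {K m : ℕ}
    (hK : ∀ i < K, i ≤ m → i ∈ X) (h : ¬ Disjoint X (Finset.Ioc (m - K) m)) : m ∈ X + X := by
  obtain ⟨y, hy, hym⟩ := Finset.not_disjoint_iff.mp h
  rw [Finset.mem_Ioc] at hym
  exact Finset.mem_add.mpr ⟨y, hy, m - y, hK _ (by omega) (by omega), by omega⟩

/-- For `2 ^ K ≥ 2 (n + 1)`, at least half of the sets obtained from `[0, K)` by adding elements of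
`[K, n]` are additive 2-bases for `n`. -/
lemma two_pow_le_two_pow_mul_card_bases (n K : ℕ) (hK : 2 * (n + 1) ≤ 2 ^ K) :
    2 ^ n ≤ 2 ^ K * ((Finset.range (n + 1)).powerset.filter
      (fun X : Finset ℕ => Finset.range (n + 1) ⊆ X + X)).card := by
  classical
  have hK0 : 0 < K := by
    rcases Nat.eq_zero_or_pos K with rfl | h
    · simp at hK; omega
    · exact h
  set F := (Finset.Ico K (n + 1)).powerset with hF
  set B := (Finset.Ico (2 * K - 1) (n + 1)).biUnion
    (fun m => (Finset.Ico K (n + 1) \ Finset.Ioc (m - K) m).powerset) with hB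
  set G := (Finset.range (n + 1)).powerset.filter
    (fun X : Finset ℕ => Finset.range (n + 1) ⊆ X + X) with hG
  have hFcard : F.card = 2 ^ (n + 1 - K) := by simp [hF]
  have hBcard : 2 * B.card ≤ 2 ^ (n + 1 - K) := by
    by_cases hn : n + 1 < 2 * K
    · have : B = ∅ := by
        rw [hB, Finset.Ico_eq_empty (by omega), Finset.biUnion_empty]
      simp [this]
    · have h1 : B.card ≤ (Finset.Ico (2 * K - 1) (n + 1)).card * 2 ^ (n + 1 - 2 * K) := by
        refine Finset.card_biUnion_le_card_mul _ _ _ fun m hm => ?_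
        rw [Finset.mem_Ico] at hm
        rw [Finset.card_powerset, Finset.card_sdiff_of_subset]
        · simp only [Nat.card_Ico, Nat.card_Ioc]
          exact Nat.pow_le_pow_right two_pos (by omega)
        · intro x hx
          simp only [Finset.mem_Ioc, Finset.mem_Ico] at hx ⊢
          omega
      calc 2 * B.card ≤ 2 * ((n + 1) * 2 ^ (n + 1 - 2 * K)) := by
            refine Nat.mul_le_mul_left _ (h1.trans (Nat.mul_le_mul_right _ ?_))
            simp
        _ = 2 * (n + 1) * 2 ^ (n + 1 - 2 * K) := by ring
        _ ≤ 2 ^ K * 2 ^ (n + 1 - 2 * K) := Nat.mul_le_mul_right _ hK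
        _ = 2 ^ (n + 1 - K) := by rw [← pow_add]; congr 1; omega
  have hcard : (F \ B).card ≤ G.card := by
    refine Finset.card_le_card_of_injOn (fun Y => Finset.range (min K (n + 1)) ∪ Y) ?_ ?_
    · intro Y hY
      simp only [hF, hB, Finset.coe_sdiff, Set.mem_sdiff, Finset.mem_coe, Finset.mem_powerset,
        Finset.mem_biUnion, not_exists, not_and] at hY
      obtain ⟨hYF, hYB⟩ := hY
      simp only [hG, Finset.coe_filter, Finset.mem_powerset, Set.mem_ofPred_eq]
      refine ⟨Finset.union_subset (Finset.range_subset_range.mpr (min_le_right _ _)) fun y hy => ?_,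
        fun m hm => ?_⟩
      · have := Finset.mem_Ico.mp (hYF hy)
        exact Finset.mem_range.mpr this.2
      · rw [Finset.mem_range] at hm
        have hinit : ∀ i < K, i ≤ m → i ∈ Finset.range (min K (n + 1)) ∪ Y := fun i hi him =>
          Finset.mem_union_left _ (Finset.mem_range.mpr (by omega))
        by_cases hmK : m < K
        · exact Finset.mem_add.mpr ⟨m, hinit m hmK le_rfl, 0, hinit 0 hK0 (by omega), by omega⟩
        refine mem_add_self_of_not_disjoint hinit fun hdis => ?_
        by_cases hm2 : m < 2 * K - 1
        · exact Finset.disjoint_left.mp hdis (hinit (K - 1) (by omega) (by omega))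
            (Finset.mem_Ioc.mpr (by omega))
        · refine hYB m (Finset.mem_Ico.mpr (by omega)) (Finset.subset_sdiff.mpr ⟨hYF, ?_⟩)
          exact hdis.mono_left Finset.subset_union_right
    · intro Y hY Z hZ hYZ
      have key : ∀ W ∈ F, Disjoint W (Finset.range (min K (n + 1))) := fun W hW =>
        Finset.disjoint_left.mpr fun x hx hx' => by
          have h1 := Finset.mem_Ico.mp (Finset.mem_powerset.mp hW hx)
          have h2 := Finset.mem_range.mp hx'
          omega
      have hY' := key Y (Finset.mem_sdiff.mp hY).1
      have hZ' := key Z (Finset.mem_sdiff.mp hZ).1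
      have := congrArg (· \ Finset.range (min K (n + 1))) hYZ
      simpa [Finset.union_sdiff_left, Finset.sdiff_eq_self_of_disjoint hY',
        Finset.sdiff_eq_self_of_disjoint hZ'] using this
  have h2 : 2 ^ (n + 1 - K) ≤ 2 * G.card := by
    have := Finset.le_card_sdiff B F
    omega
  have h3 : 2 * 2 ^ n ≤ 2 * (2 ^ K * G.card) := calc
    2 * 2 ^ n = 2 ^ (n + 1) := by ring
    _ ≤ 2 ^ (K + (n + 1 - K)) := Nat.pow_le_pow_right two_pos (by omega)
    _ = 2 ^ K * 2 ^ (n + 1 - K) := pow_add _ _ _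
    _ ≤ 2 ^ K * (2 * G.card) := Nat.mul_le_mul_left _ h2
    _ = 2 * (2 ^ K * G.card) := by ring
  omega

/-- For every `n ≥ 0`, the number of additive 2-bases for `n` satisfies
`|Γ(n)| ≥ 2^n / (n+1)^20`. -/
theorem card_bases_ge (n : ℕ) :
    (2 : ℝ) ^ n / (n + 1) ^ 20 ≤
      (((Finset.range (n + 1)).powerset.filter
          (fun X : Finset ℕ => Finset.range (n + 1) ⊆ X + X)).card : ℝ) := by
  set g := ((Finset.range (n + 1)).powerset.filter
    (fun X : Finset ℕ => Finset.range (n + 1) ⊆ X + X)).card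
  have hlog : 2 ^ (Nat.log 2 (n + 1) + 2) ≤ 4 * (n + 1) := by
    have := Nat.pow_log_le_self 2 (Nat.succ_ne_zero n)
    rw [Nat.succ_eq_add_one] at this
    rw [pow_add]
    omega
  have hlog' : 2 * (n + 1) ≤ 2 ^ (Nat.log 2 (n + 1) + 2) := by
    have := Nat.lt_pow_succ_log_self one_lt_two (n + 1)
    rw [Nat.succ_eq_add_one] at this
    rw [pow_succ]
    omega
  have hmain : 2 ^ n ≤ 4 * (n + 1) * g :=
    (two_pow_le_two_pow_mul_card_bases n _ hlog').trans (Nat.mul_le_mul_right _ hlog)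
  clear_value g
  have hfinal : 2 ^ n ≤ g * (n + 1) ^ 20 := by
    rcases Nat.eq_zero_or_pos n with rfl | hn
    · simp only [pow_zero, zero_add, one_pow, mul_one] at hmain ⊢
      omega
    · have h19 : 4 ≤ (n + 1) ^ 19 := calc
        4 ≤ 2 ^ 19 := by norm_num
        _ ≤ (n + 1) ^ 19 := Nat.pow_le_pow_left (by omega) _
      calc 2 ^ n ≤ 4 * (n + 1) * g := hmain
        _ ≤ (n + 1) ^ 19 * (n + 1) * g := by gcongr
        _ = g * (n + 1) ^ 20 := by ring
  have hpos : (0 : ℝ) < ((n : ℝ) + 1) ^ 20 := pow_pos (Nat.cast_add_one_pos n) 20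
  have hcast : (2 : ℝ) ^ n ≤ (g : ℝ) * ((n : ℝ) + 1) ^ 20 := by exact_mod_cast hfinal
  exact (div_le_iff₀ hpos).mpr hcast
end

section
/- For every non-negative integer n, the number of subsets X ⊆ [n]₀ with |[n]₀ \ (X + X)| ≤ 20 is at least 2^n. -/
open Pointwise

/-- Subsets of `S` containing none of `m` disjoint pairs `{i, k - i} ⊆ S` form a proportion
at most `(3 / 4) ^ m` of all subsets. -/
theorem card_filter_avoid_pairs_le (k m : ℕ) (hm : 2 * m ≤ k + 1) (S : Finset ℕ)
    (hS : ∀ i < m, i ∈ S ∧ k - i ∈ S) :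
    4 ^ m * (S.powerset.filter fun X => ∀ i < m, ¬(i ∈ X ∧ k - i ∈ X)).card
      ≤ 3 ^ m * 2 ^ S.card := by
  induction m generalizing S with
  | zero => simp
  | succ m ih =>
    obtain ⟨ha, hb⟩ := hS m (by omega)
    set T := (S.erase m).erase (k - m) with hT
    have hb' : k - m ∈ S.erase m := Finset.mem_erase.2 ⟨by omega, hb⟩
    have hcard : S.card = T.card + 2 := by
      have h₁ := Finset.card_erase_add_one ha
      have h₂ := Finset.card_erase_add_one hb'
      rw [← hT] at h₂
      omega
    have hTmem : ∀ i < m, i ∈ T ∧ k - i ∈ T := fun i hi => by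
      have := hS i (by omega)
      simp only [hT, Finset.mem_erase]
      refine ⟨⟨?_, ?_, this.1⟩, ?_, ?_, this.2⟩ <;> omega
    set B := T.powerset.filter fun X => ∀ i < m, ¬(i ∈ X ∧ k - i ∈ X) with hB
    have hsub : (S.powerset.filter fun X => ∀ i < m + 1, ¬(i ∈ X ∧ k - i ∈ X))
        ⊆ (B ∪ B.image (insert m)) ∪ B.image (insert (k - m)) := by
      intro X hX
      rw [Finset.mem_filter, Finset.mem_powerset] at hX
      obtain ⟨hXS, hX⟩ := hX
      have hY : (X.erase m).erase (k - m) ∈ B := by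
        rw [hB, Finset.mem_filter, Finset.mem_powerset]
        refine ⟨Finset.erase_subset_erase _ (Finset.erase_subset_erase _ hXS), fun i hi h => ?_⟩
        exact hX i (by omega) ⟨Finset.mem_of_mem_erase (Finset.mem_of_mem_erase h.1),
          Finset.mem_of_mem_erase (Finset.mem_of_mem_erase h.2)⟩
      have hpair := hX m (by omega)
      simp only [Finset.mem_union, Finset.mem_image]
      by_cases h₁ : m ∈ X
      · have h₂ : k - m ∉ X := fun h => hpair ⟨h₁, h⟩
        refine Or.inl (Or.inr ⟨_, hY, ?_⟩)
        rw [Finset.erase_eq_of_notMem (fun h => h₂ (Finset.mem_of_mem_erase h)),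
          Finset.insert_erase h₁]
      · rw [Finset.erase_eq_of_notMem h₁] at hY
        by_cases h₂ : k - m ∈ X
        · exact Or.inr ⟨_, hY, Finset.insert_erase h₂⟩
        · rw [Finset.erase_eq_of_notMem h₂] at hY
          exact Or.inl (Or.inl hY)
    have hle := Finset.card_le_card hsub
    have h₁ := Finset.card_union_le (B ∪ B.image (insert m)) (B.image (insert (k - m)))
    have h₂ := Finset.card_union_le B (B.image (insert m))
    have h₃ := Finset.card_image_le (s := B) (f := insert m)
    have h₄ := Finset.card_image_le (s := B) (f := insert (k - m))
    have hB3 := hle.trans (show _ ≤ 3 * B.card by omega)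
    calc _ ≤ 4 ^ (m + 1) * (3 * B.card) := Nat.mul_le_mul_left _ hB3
      _ = 12 * (4 ^ m * B.card) := by ring
      _ ≤ 12 * (3 ^ m * 2 ^ T.card) := Nat.mul_le_mul_left _ (ih (by omega) T hTmem)
      _ = 3 ^ (m + 1) * 2 ^ S.card := by rw [hcard]; ring

theorem card_filter_notMem_add_le (n k : ℕ) (hk : k ≤ n) :
    (((Finset.range (n + 1)).powerset.filter fun X => k ∉ X + X).card : ℚ)
      ≤ (3 / 4) ^ ((k + 1) / 2) * 2 ^ (n + 1) := by
  have h := card_filter_avoid_pairs_le k ((k + 1) / 2) (by omega) (Finset.range (n + 1))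
    (fun i hi => by simp only [Finset.mem_range]; omega)
  rw [Finset.card_range] at h
  have hsub : ((Finset.range (n + 1)).powerset.filter fun X => k ∉ X + X) ⊆
      (Finset.range (n + 1)).powerset.filter
        fun X => ∀ i < (k + 1) / 2, ¬(i ∈ X ∧ k - i ∈ X) := by
    refine Finset.monotone_filter_right _ fun X _ hX i hi hmem => hX ?_
    exact Finset.mem_add.2 ⟨i, hmem.1, k - i, hmem.2, by omega⟩
  have h' := (Nat.mul_le_mul_left (4 ^ ((k + 1) / 2)) (Finset.card_le_card hsub)).trans h
  rw [div_pow, div_mul_eq_mul_div, le_div_iff₀ (by positivity), mul_comm]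
  exact_mod_cast h'

theorem sum_three_quarters_pow_le (N : ℕ) :
    ∑ k ∈ Finset.range N, (3 / 4 : ℚ) ^ ((k + 1) / 2) ≤ 7 := by
  have h : ∀ j : ℕ, ∑ k ∈ Finset.range (2 * j + 1), (3 / 4 : ℚ) ^ ((k + 1) / 2)
      = 7 - 6 * (3 / 4) ^ j := by
    intro j
    induction j with
    | zero => norm_num
    | succ j ih =>
      rw [show 2 * (j + 1) + 1 = 2 * j + 1 + 1 + 1 by ring, Finset.sum_range_succ,
        Finset.sum_range_succ, ih, show (2 * j + 1 + 1) / 2 = j + 1 by omega,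
        show (2 * j + 1 + 1 + 1) / 2 = j + 1 by omega]
      ring
  calc _ ≤ ∑ k ∈ Finset.range (2 * N + 1), (3 / 4 : ℚ) ^ ((k + 1) / 2) :=
        Finset.sum_le_sum_of_subset_of_nonneg (Finset.range_subset_range.2 (by omega))
          fun _ _ _ => by positivity
    _ ≤ 7 := by
      rw [h]
      have : (0 : ℚ) ≤ (3 / 4) ^ N := by positivity
      linarith

/-- For every `n ≥ 0`, the number of subsets `X ⊆ [n]₀` with
`|[n]₀ \ (X + X)| ≤ 20` is at least `2^n`. -/
theorem card_almost_bases_ge (n : ℕ) :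
    2 ^ n ≤ ((Finset.range (n + 1)).powerset.filter
        (fun X : Finset ℕ => (Finset.range (n + 1) \ (X + X)).card ≤ 20)).card := by
  set P := (Finset.range (n + 1)).powerset with hP
  have hsum : ∑ X ∈ P, ((Finset.range (n + 1) \ (X + X)).card : ℚ) ≤ 7 * 2 ^ (n + 1) := by
    have hswap : ∑ X ∈ P, (Finset.range (n + 1) \ (X + X)).card
        = ∑ k ∈ Finset.range (n + 1), (P.filter fun X => k ∉ X + X).card := by
      simp only [Finset.sdiff_eq_filter, Finset.card_filter]
      exact Finset.sum_comm
    rw [← Nat.cast_sum, hswap, Nat.cast_sum]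
    calc _ ≤ ∑ k ∈ Finset.range (n + 1), (3 / 4 : ℚ) ^ ((k + 1) / 2) * 2 ^ (n + 1) :=
          Finset.sum_le_sum fun k hk =>
            card_filter_notMem_add_le n k (Nat.lt_succ_iff.1 (Finset.mem_range.1 hk))
      _ ≤ 7 * 2 ^ (n + 1) := by
        rw [← Finset.sum_mul]
        gcongr
        exact sum_three_quarters_pow_le _
  have hsum' : ∑ X ∈ P, (Finset.range (n + 1) \ (X + X)).card ≤ 7 * 2 ^ (n + 1) := by
    exact_mod_cast hsum
  have hbad : (P.filter fun X => ¬(Finset.range (n + 1) \ (X + X)).card ≤ 20).card * 21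
      ≤ ∑ X ∈ P, (Finset.range (n + 1) \ (X + X)).card :=
    (Finset.card_nsmul_le_sum _ _ 21 fun X hX =>
      Nat.lt_of_not_le (Finset.mem_filter.1 hX).2).trans
      (Finset.sum_le_sum_of_subset (Finset.filter_subset _ _))
  have htot := Finset.card_filter_add_card_filter_not (s := P)
    (fun X => (Finset.range (n + 1) \ (X + X)).card ≤ 20)
  have hPcard : P.card = 2 ^ (n + 1) := by rw [hP, Finset.card_powerset, Finset.card_range]
  rw [hPcard] at htot
  rw [pow_succ] at htot hsum'
  omega
end

section
/- For every non-negative integer n, the number of additive 2-bases X for n with n+1 ∉ X + X satisfies |{X ∈ Γ(n) : n+1 ∉ X + X}| ≤ 2 · (3/4)^((n−1)/2) · (n+1)^20 · |Γ(n)|, where the exponent (n−1)/2 is a real number. -/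
open Pointwise

/-- Sets `X ⊆ {0, …, n}` with `n + 1 ∉ X + X` contain at most one element of each pair
`{i, n + 1 - i}`, so there are at most `2 * 3 ^ (n / 2)` of them. -/
theorem card_powerset_filter_notMem_add_le (n : ℕ) :
    ((Finset.range (n + 1)).powerset.filter (fun X : Finset ℕ => n + 1 ∉ X + X)).card ≤
      2 * 3 ^ (n / 2) := by
  classical
  let f : Finset ℕ → Bool × (Fin (n / 2) → Fin 3) := fun X =>
    (decide (0 ∈ X), fun i => if (i : ℕ) + 1 ∈ X then 0 else if n - i ∈ X then 1 else 2)
  have key : ∀ X Y : Finset ℕ, X ⊆ Finset.range (n + 1) → n + 1 ∉ X + X → f X = f Y → X ⊆ Y := by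
    intro X Y hX hX' hXY x hx
    have hxn : x < n + 1 := Finset.mem_range.1 (hX hx)
    have hsum : ∀ y ∈ X, x + y ≠ n + 1 := fun y hy h =>
      hX' (h ▸ Finset.add_mem_add hx hy)
    obtain ⟨h0, hf⟩ := Prod.ext_iff.1 hXY
    rcases Nat.eq_zero_or_pos x with rfl | hpos
    · simpa [f, hx] using h0
    · by_cases h1 : x ≤ n / 2
      · have h := congrFun hf ⟨x - 1, by omega⟩
        have e : x - 1 + 1 = x := by omega
        simp only [f, e, hx, if_true] at h
        by_contra hxY
        rw [if_neg hxY] at h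
        split_ifs at h <;> simp at h
      · by_cases h2 : n - x < n / 2
        · have h := congrFun hf ⟨n - x, h2⟩
          have e : n - (n - x) = x := by omega
          have hn : n - x + 1 ∉ X := fun hy => hsum _ hy (by omega)
          simp only [f, e, hx, hn, if_true, if_false] at h
          by_contra hxY
          rw [if_neg hxY] at h
          split_ifs at h <;> simp at h
        · exact absurd (show x + x = n + 1 by omega) (hsum x hx)
  have hcard := Finset.card_le_card_of_injOn (t := Finset.univ) f
    (s := (Finset.range (n + 1)).powerset.filter (fun X : Finset ℕ => n + 1 ∉ X + X))
    (fun _ _ => Finset.mem_coe.2 (Finset.mem_univ _)) (by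
      intro X hX Y hY h
      simp only [Finset.coe_filter, Finset.mem_powerset, Set.mem_ofPred_eq] at hX hY
      exact Finset.Subset.antisymm (key X Y hX.1 hX.2 h) (key Y X hY.1 hY.2 h.symm))
  simpa using hcard

/-- If `n ≤ 2 ^ m`, at least half of the sets between `{0, …, m}` and `{0, …, n}` are additive
2-bases for `n`. -/
theorem two_pow_le_card_bases {n m : ℕ} (hm : m ≤ n) (hn : n ≤ 2 ^ m) :
    2 ^ (n - m) ≤ 2 * ((Finset.range (n + 1)).powerset.filter
      (fun X : Finset ℕ => Finset.range (n + 1) ⊆ X + X)).card := by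
  classical
  set G := (Finset.range (n + 1)).powerset.filter
      (fun X : Finset ℕ => Finset.range (n + 1) ⊆ X + X)
  let A := Finset.range (m + 1)
  let K := Finset.Icc (2 * m + 1) n
  let B : ℕ → Finset (Finset ℕ) := fun k =>
    Finset.Icc A (Finset.range (n + 1) \ Finset.Icc (k - m) k)
  have hcover : Finset.Icc A (Finset.range (n + 1)) ⊆ G ∪ K.biUnion B := by
    intro X hX
    obtain ⟨hAX, hXn⟩ := Finset.mem_Icc.1 hX
    rw [Finset.mem_union, or_iff_not_imp_right]
    intro hbad
    refine Finset.mem_filter.2 ⟨Finset.mem_powerset.2 hXn, fun k hk => ?_⟩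
    have hk := Finset.mem_range.1 hk
    have hA : ∀ i ≤ m, i ∈ X := fun i hi => hAX (Finset.mem_range.2 (by omega))
    by_cases hkm : k ≤ 2 * m
    · have e : k / 2 + (k - k / 2) = k := by omega
      exact e ▸ Finset.add_mem_add (hA _ (by omega)) (hA _ (by omega))
    · by_contra hkX
      refine hbad (Finset.mem_biUnion.2 ⟨k, Finset.mem_Icc.2 (by omega), Finset.mem_Icc.2
        ⟨hAX, fun x hx => Finset.mem_sdiff.2 ⟨hXn hx, fun hxk => hkX ?_⟩⟩⟩)
      obtain ⟨h1, h2⟩ := Finset.mem_Icc.1 hxk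
      have e : k - x + x = k := by omega
      exact e ▸ Finset.add_mem_add (hA _ (by omega)) hx
  have hB : ∀ k ∈ K, (B k).card ≤ 2 ^ (n - m - (m + 1)) := by
    intro k hk
    obtain ⟨h1, h2⟩ := Finset.mem_Icc.1 hk
    have hsub : Finset.Icc (k - m) k ⊆ Finset.range (n + 1) := fun x hx => by
      have := Finset.mem_Icc.1 hx
      exact Finset.mem_range.2 (by omega)
    have hA : A ⊆ Finset.range (n + 1) \ Finset.Icc (k - m) k := fun x hx => by
      have := Finset.mem_range.1 hx
      simp only [Finset.mem_sdiff, Finset.mem_range, Finset.mem_Icc]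
      omega
    rw [Finset.card_Icc_finset hA, Finset.card_sdiff_of_subset hsub]
    refine Nat.pow_le_pow_right (by norm_num) ?_
    simp only [Finset.card_range, Nat.card_Icc, A]
    omega
  have hcard := (Finset.card_le_card hcover).trans (Finset.card_union_le _ _)
  have hU : (K.biUnion B).card ≤ K.card * 2 ^ (n - m - (m + 1)) :=
    Finset.card_biUnion_le_card_mul _ _ _ hB
  rw [Finset.card_Icc_finset (Finset.range_subset_range.2 (by omega))] at hcard
  simp only [Finset.card_range] at hcard
  have e : n + 1 - (m + 1) = n - m := by omega
  rw [e] at hcard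
  have hhalf : 2 * (K.card * 2 ^ (n - m - (m + 1))) ≤ 2 ^ (n - m) := by
    by_cases h : 2 * m + 1 ≤ n
    · have hK : K.card ≤ 2 ^ m := by
        simp only [K, Nat.card_Icc]
        omega
      calc 2 * (K.card * 2 ^ (n - m - (m + 1)))
          ≤ 2 * (2 ^ m * 2 ^ (n - m - (m + 1))) := by gcongr
        _ = 2 ^ (1 + (m + (n - m - (m + 1)))) := by rw [pow_add, pow_add, pow_one]
        _ = 2 ^ (n - m) := by congr 1; omega
    · have hK : K.card = 0 := by
        simp only [K, Nat.card_Icc]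
        omega
      simp [hK]
  omega

/-- Additive 2-bases for `n` make up at least a polynomial fraction of all subsets. -/
theorem two_pow_succ_le_card_bases (n : ℕ) :
    2 ^ (n + 1) ≤ 2 * (n + 1) ^ 20 * ((Finset.range (n + 1)).powerset.filter
      (fun X : Finset ℕ => Finset.range (n + 1) ⊆ X + X)).card := by
  rcases Nat.eq_zero_or_pos n with rfl | hn
  · decide
  · have hlog : 2 ^ Nat.log 2 n ≤ n := Nat.pow_log_le_self 2 hn.ne'
    have hlt : n < 2 ^ (Nat.log 2 n + 1) := Nat.lt_pow_succ_log_self (by norm_num) n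
    have hm : Nat.log 2 n + 1 ≤ n := Nat.log_lt_self 2 hn.ne'
    have h := two_pow_le_card_bases hm hlt.le
    generalize ((Finset.range (n + 1)).powerset.filter
      (fun X : Finset ℕ => Finset.range (n + 1) ⊆ X + X)).card = g at h ⊢
    have hpoly : 8 * n ≤ 2 * (n + 1) ^ 20 := by
      have : 2 ^ 19 ≤ (n + 1) ^ 19 := Nat.pow_le_pow_left (by omega) 19
      calc 8 * n ≤ 2 * (2 ^ 19 * (n + 1)) := by omega
        _ ≤ 2 * ((n + 1) ^ 19 * (n + 1)) := by gcongr
        _ = 2 * (n + 1) ^ 20 := by ring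
    calc 2 ^ (n + 1) = 2 ^ Nat.log 2 n * 4 * 2 ^ (n - (Nat.log 2 n + 1)) := by
          rw [show 4 = 2 ^ 2 from rfl, ← pow_add, ← pow_add]
          congr 1
          omega
      _ ≤ n * 4 * (2 * g) := by gcongr
      _ = 8 * n * g := by ring
      _ ≤ 2 * (n + 1) ^ 20 * g := by gcongr

/-- For every `n ≥ 0`, the number of additive 2-bases `X` for `n` with `n+1 ∉ X + X`
satisfies `|{X ∈ Γ(n) : n+1 ∉ X+X}| ≤ 2 · (3/4)^((n-1)/2) · (n+1)^20 · |Γ(n)|`,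
where the exponent `(n-1)/2` is real. -/
theorem card_bases_missing_top_le (n : ℕ) :
    ((((Finset.range (n + 1)).powerset.filter
          (fun X : Finset ℕ => Finset.range (n + 1) ⊆ X + X)).filter
        (fun X : Finset ℕ => n + 1 ∉ X + X)).card : ℝ) ≤
      2 * (3 / 4 : ℝ) ^ (((n : ℝ) - 1) / 2) * (n + 1) ^ 20 *
        (((Finset.range (n + 1)).powerset.filter
            (fun X : Finset ℕ => Finset.range (n + 1) ⊆ X + X)).card : ℝ) := by
  have hle := (Finset.card_le_card (Finset.filter_subset_filter
    (fun X : Finset ℕ => n + 1 ∉ X + X) (Finset.filter_subset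
      (fun X : Finset ℕ => Finset.range (n + 1) ⊆ X + X) _))).trans
    (card_powerset_filter_notMem_add_le n)
  have hΓ := two_pow_succ_le_card_bases n
  have hle' := (Nat.cast_le (α := ℝ)).2 hle
  have hΓ' := (Nat.cast_le (α := ℝ)).2 hΓ
  push_cast at hle' hΓ'
  have hexp : (3 / 4 : ℝ) ^ (n / 2) ≤ (3 / 4 : ℝ) ^ (((n : ℝ) - 1) / 2) := by
    rw [← Real.rpow_natCast]
    refine Real.rpow_le_rpow_of_exponent_ge (by norm_num) (by norm_num) ?_
    have : (n : ℝ) ≤ 2 * (n / 2 : ℕ) + 1 := by exact_mod_cast (by omega : n ≤ 2 * (n / 2) + 1)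
    linarith
  have hpow : (2 : ℝ) * 4 ^ (n / 2) ≤ 2 ^ (n + 1) := by
    rw [show (4 : ℝ) = 2 ^ 2 by norm_num, ← pow_mul, ← pow_succ']
    exact pow_le_pow_right₀ (by norm_num) (by omega)
  refine hle'.trans ?_
  calc (2 : ℝ) * 3 ^ (n / 2) = (3 / 4) ^ (n / 2) * (2 * 4 ^ (n / 2)) := by
        rw [div_pow]
        field_simp
    _ ≤ (3 / 4 : ℝ) ^ (((n : ℝ) - 1) / 2) * 2 ^ (n + 1) := by gcongr
    _ ≤ _ := mul_le_mul_of_nonneg_left hΓ' (by positivity)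
    _ = _ := by rw [← mul_assoc, ← mul_assoc, mul_comm _ (2 : ℝ)]
end

section
/- For every non-negative integer n, |Γ(n+1)| ≥ (2 − t(n)) · |Γ(n)|, where t(n) = (4/√3) · (√3/2)^n · (n+1)^20. -/
open Pointwise

/-- The additive 2-bases for `n`. -/
def additiveBases (n : ℕ) : Finset (Finset ℕ) :=
  (Finset.range (n + 1)).powerset.filter (fun X : Finset ℕ => Finset.range (n + 1) ⊆ X + X)

lemma mem_additiveBases {n : ℕ} {X : Finset ℕ} :
    X ∈ additiveBases n ↔ X ⊆ Finset.range (n + 1) ∧ Finset.range (n + 1) ⊆ X + X := by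
  simp [additiveBases]

lemma zero_mem_of_mem_additiveBases {n : ℕ} {X : Finset ℕ} (hX : X ∈ additiveBases n) :
    0 ∈ X := by
  have h := (mem_additiveBases.1 hX).2 (Finset.mem_range.2 n.succ_pos)
  obtain ⟨a, ha, b, hb, hab⟩ := Finset.mem_add.1 h
  obtain rfl : a = 0 := by omega
  exact ha

/-- Every base for `n` extends to a base for `n + 1` by adding `n + 1`, and is itself a base for
`n + 1` unless `n + 1` is missing from its sumset. -/
lemma two_mul_card_additiveBases_le (n : ℕ) :
    2 * (additiveBases n).card ≤ (additiveBases (n + 1)).card +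
      ((additiveBases n).filter (fun X => n + 1 ∉ X + X)).card := by
  have hnot : ∀ X ∈ additiveBases n, n + 1 ∉ X := fun X hX h => by
    simpa using (mem_additiveBases.1 hX).1 h
  have himage : ((additiveBases n).image (insert (n + 1))).card = (additiveBases n).card := by
    refine Finset.card_image_of_injOn fun X hX Y hY h => ?_
    rw [← Finset.erase_insert (hnot X hX), ← Finset.erase_insert (hnot Y hY)]
    exact congrArg (fun Z => Finset.erase Z (n + 1)) h
  have hdisj : Disjoint ((additiveBases n).image (insert (n + 1)))
      ((additiveBases n).filter (fun X => n + 1 ∈ X + X)) := by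
    refine Finset.disjoint_left.2 fun Y hY hY' => ?_
    obtain ⟨X, -, rfl⟩ := Finset.mem_image.1 hY
    exact hnot _ (Finset.mem_filter.1 hY').1 (Finset.mem_insert_self _ _)
  have hsub : (additiveBases n).image (insert (n + 1)) ∪
      (additiveBases n).filter (fun X => n + 1 ∈ X + X) ⊆ additiveBases (n + 1) := by
    refine Finset.union_subset (fun Y hY => ?_) (fun X hX => ?_)
    · obtain ⟨X, hX, rfl⟩ := Finset.mem_image.1 hY
      obtain ⟨h1, h2⟩ := mem_additiveBases.1 hX
      refine mem_additiveBases.2 ⟨?_, ?_⟩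
      · rw [Finset.range_add_one (n := n + 1)]
        exact Finset.insert_subset_insert _ h1
      · rw [Finset.range_add_one (n := n + 1)]
        refine Finset.insert_subset ?_ (h2.trans (Finset.add_subset_add
          (Finset.subset_insert _ _) (Finset.subset_insert _ _)))
        exact Finset.mem_add.2 ⟨n + 1, Finset.mem_insert_self _ _, 0,
          Finset.mem_insert_of_mem (zero_mem_of_mem_additiveBases hX), rfl⟩
    · obtain ⟨hX, h⟩ := Finset.mem_filter.1 hX
      obtain ⟨h1, h2⟩ := mem_additiveBases.1 hX
      refine mem_additiveBases.2 ⟨h1.trans (Finset.range_mono (by omega)), ?_⟩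
      rw [Finset.range_add_one (n := n + 1)]
      exact Finset.insert_subset h h2
  have hcard := Finset.card_le_card hsub
  rw [Finset.card_union_of_disjoint hdisj, himage] at hcard
  have hsplit := Finset.card_filter_add_card_filter_not (s := additiveBases n)
    (fun X => n + 1 ∈ X + X)
  omega

/-- At most one element of each pair `{i + 1, n - i}` can belong to a set whose sumset misses
`n + 1`. -/
lemma card_additiveBases_filter_notMem_le (n : ℕ) :
    ((additiveBases n).filter (fun X => n + 1 ∉ X + X)).card ≤ 3 ^ (n / 2) := by
  have hcard : (Finset.univ : Finset (Fin (n / 2) → Fin 3)).card = 3 ^ (n / 2) := by simp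
  rw [← hcard]
  refine Finset.card_le_card_of_injOn
    (fun X i => if (i : ℕ) + 1 ∈ X then 0 else if n - i ∈ X then 1 else 2)
    (fun _ _ => Finset.mem_coe.2 (Finset.mem_univ _)) fun X hX Y hY h => ?_
  obtain ⟨hX, hXn⟩ := Finset.mem_filter.1 (Finset.mem_coe.1 hX)
  obtain ⟨hY, hYn⟩ := Finset.mem_filter.1 (Finset.mem_coe.1 hY)
  have hXadd : ∀ a ∈ X, ∀ b ∈ X, a + b ≠ n + 1 := fun a ha b hb hab =>
    hXn (Finset.mem_add.2 ⟨a, ha, b, hb, hab⟩)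
  have hYadd : ∀ a ∈ Y, ∀ b ∈ Y, a + b ≠ n + 1 := fun a ha b hb hab =>
    hYn (Finset.mem_add.2 ⟨a, ha, b, hb, hab⟩)
  have hpair : ∀ i < n / 2, (i + 1 ∈ X ↔ i + 1 ∈ Y) ∧ (n - i ∈ X ↔ n - i ∈ Y) := by
    intro i hi
    have hi' := congrFun h ⟨i, hi⟩
    have hX' := fun h1 h2 => hXadd (i + 1) h1 (n - i) h2 (by omega)
    have hY' := fun h1 h2 => hYadd (i + 1) h1 (n - i) h2 (by omega)
    by_cases h1 : i + 1 ∈ X <;> by_cases h2 : n - i ∈ X <;> by_cases h3 : i + 1 ∈ Y <;>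
      by_cases h4 : n - i ∈ Y <;> simp_all
  ext x
  rcases Nat.eq_zero_or_pos x with rfl | hx0
  · simp [zero_mem_of_mem_additiveBases hX, zero_mem_of_mem_additiveBases hY]
  rcases Nat.lt_or_ge n x with hxn | hxn
  · refine iff_of_false (fun hx => ?_) (fun hx => ?_)
    · have := Finset.mem_range.1 ((mem_additiveBases.1 hX).1 hx)
      omega
    · have := Finset.mem_range.1 ((mem_additiveBases.1 hY).1 hx)
      omega
  rcases Nat.lt_or_ge (x - 1) (n / 2) with hlow | hlow
  · have := (hpair (x - 1) hlow).1
    rwa [Nat.sub_add_cancel hx0] at this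
  rcases Nat.lt_or_ge (n - x) (n / 2) with hhigh | hhigh
  · have := (hpair (n - x) hhigh).2
    rwa [Nat.sub_sub_self hxn] at this
  · have hmid : x + x = n + 1 := by omega
    exact iff_of_false (fun hx => hXadd x hx x hx hmid) (fun hx => hYadd x hx x hx hmid)

/-- If `n ≤ 2 ^ L`, at least half of the sets containing `{0, …, L}` are bases for `n`. -/
lemma two_pow_le_mul_card_additiveBases {n L : ℕ} (hLn : L ≤ n) (hL : n ≤ 2 ^ L) :
    2 ^ n ≤ 2 ^ (L + 1) * (additiveBases n).card := by
  set U := Finset.Ioc L n with hU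
  set bad : ℕ → Finset (Finset ℕ) := fun m => (U \ Finset.Icc (m - L) m).powerset with hbad
  set B := (Finset.Ioc (2 * L) n).biUnion bad with hB
  have hbadcard : ∀ m ∈ Finset.Ioc (2 * L) n, (bad m).card * 2 ^ (L + 1) = 2 ^ (n - L) := by
    intro m hm
    obtain ⟨hm1, hm2⟩ := Finset.mem_Ioc.1 hm
    have hsub : Finset.Icc (m - L) m ⊆ U := fun x hx => by
      rw [hU, Finset.mem_Ioc]
      rw [Finset.mem_Icc] at hx
      omega
    rw [hbad, Finset.card_powerset, Finset.card_sdiff_of_subset hsub, hU, Nat.card_Ioc,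
      Nat.card_Icc, ← pow_add]
    congr 1
    omega
  have hBcard : B.card * 2 ^ (L + 1) ≤ 2 ^ L * 2 ^ (n - L) := calc
    B.card * 2 ^ (L + 1) ≤ (∑ m ∈ Finset.Ioc (2 * L) n, (bad m).card) * 2 ^ (L + 1) :=
      Nat.mul_le_mul_right _ Finset.card_biUnion_le
    _ = ∑ m ∈ Finset.Ioc (2 * L) n, 2 ^ (n - L) := by
      rw [Finset.sum_mul]
      exact Finset.sum_congr rfl hbadcard
    _ = (n - 2 * L) * 2 ^ (n - L) := by simp
    _ ≤ 2 ^ L * 2 ^ (n - L) := Nat.mul_le_mul_right _ ((Nat.sub_le _ _).trans hL)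
  have hBhalf : 2 * B.card ≤ 2 ^ (n - L) := by
    refine le_of_mul_le_mul_left ?_ (Nat.two_pow_pos L)
    calc 2 ^ L * (2 * B.card) = B.card * 2 ^ (L + 1) := by ring
      _ ≤ _ := hBcard
  have hUcard : U.powerset.card = 2 ^ (n - L) := by
    rw [Finset.card_powerset, hU, Nat.card_Ioc]
  have hgood : (U.powerset \ B).card ≤ (additiveBases n).card := by
    refine Finset.card_le_card_of_injOn (fun T => Finset.range (L + 1) ∪ T) ?_ ?_
    · intro T hT
      obtain ⟨hTU, hTB⟩ := Finset.mem_sdiff.1 (Finset.mem_coe.1 hT)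
      rw [Finset.mem_powerset] at hTU
      refine Finset.mem_coe.2 (mem_additiveBases.2 ⟨?_, fun m hm => ?_⟩)
      · refine Finset.union_subset (Finset.range_mono (by omega)) fun x hx => ?_
        have := Finset.mem_Ioc.1 (hTU hx)
        exact Finset.mem_range.2 (by omega)
      · rw [Finset.mem_range] at hm
        rcases Nat.lt_or_ge (2 * L) m with h | h
        · have hT' : T ∉ bad m := fun hT' =>
            hTB (Finset.mem_biUnion.2 ⟨m, Finset.mem_Ioc.2 ⟨h, by omega⟩, hT'⟩)
          obtain ⟨x, hxT, hx⟩ : ∃ x ∈ T, x ∈ Finset.Icc (m - L) m := by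
            by_contra! hne
            exact hT' (Finset.mem_powerset.2 fun x hx =>
              Finset.mem_sdiff.2 ⟨hTU hx, hne x hx⟩)
          rw [Finset.mem_Icc] at hx
          exact Finset.mem_add.2 ⟨x, Finset.mem_union_right _ hxT, m - x,
            Finset.mem_union_left _ (Finset.mem_range.2 (by omega)), by omega⟩
        · exact Finset.mem_add.2 ⟨m / 2,
            Finset.mem_union_left _ (Finset.mem_range.2 (by omega)), m - m / 2,
            Finset.mem_union_left _ (Finset.mem_range.2 (by omega)), by omega⟩
    · have hdisj : ∀ T ∈ U.powerset \ B, Disjoint (Finset.range (L + 1)) T := by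
        intro T hT
        refine Finset.disjoint_left.2 fun x hx hxT => ?_
        have := Finset.mem_Ioc.1 (Finset.mem_powerset.1 (Finset.mem_sdiff.1 hT).1 hxT)
        have := Finset.mem_range.1 hx
        omega
      intro S hS T hT h
      rw [← Finset.union_sdiff_cancel_left (hdisj S hS),
        ← Finset.union_sdiff_cancel_left (hdisj T hT)]
      exact congrArg (fun Z => Z \ Finset.range (L + 1)) h
  have hdiff := Finset.le_card_sdiff B U.powerset
  have hhalf : 2 ^ (n - L) ≤ 2 * (additiveBases n).card := by omega
  calc 2 ^ n = 2 ^ L * 2 ^ (n - L) := by rw [← pow_add, Nat.add_sub_cancel' hLn]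
    _ ≤ 2 ^ L * (2 * (additiveBases n).card) := Nat.mul_le_mul_left _ hhalf
    _ = _ := by ring

lemma two_pow_le_four_mul_card_additiveBases {n : ℕ} (hn : 1 ≤ n) :
    2 ^ n ≤ 4 * n * (additiveBases n).card := by
  have hlt : 2 ^ Nat.clog 2 n ≤ 2 * n := by
    rcases hn.eq_or_lt with rfl | hn1
    · simp
    · have h1 := Nat.pow_pred_clog_lt_self one_lt_two hn1
      have h2 := Nat.clog_pos one_lt_two hn1
      rw [← Nat.succ_pred_eq_of_pos h2, pow_succ]
      omega
  have hle : Nat.clog 2 n ≤ n := Nat.clog_le_of_le_pow Nat.lt_two_pow_self.le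
  calc 2 ^ n ≤ 2 ^ (Nat.clog 2 n + 1) * (additiveBases n).card :=
      two_pow_le_mul_card_additiveBases hle (Nat.le_pow_clog one_lt_two n)
    _ ≤ 4 * n * (additiveBases n).card := by
      refine Nat.mul_le_mul_right _ ?_
      rw [pow_succ]
      omega

/-- For every `n ≥ 0`, `|Γ(n+1)| ≥ (2 - t(n)) · |Γ(n)|`, where
`t(n) = (4/√3) · (√3/2)^n · (n+1)^20`. -/
theorem card_bases_growth (n : ℕ) :
    (2 - 4 / Real.sqrt 3 * (Real.sqrt 3 / 2) ^ n * (n + 1) ^ 20) *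
        (((Finset.range (n + 1)).powerset.filter
            (fun X : Finset ℕ => Finset.range (n + 1) ⊆ X + X)).card : ℝ) ≤
      (((Finset.range (n + 2)).powerset.filter
          (fun X : Finset ℕ => Finset.range (n + 2) ⊆ X + X)).card : ℝ) := by
  change (2 - 4 / Real.sqrt 3 * (Real.sqrt 3 / 2) ^ n * (n + 1) ^ 20) *
    ((additiveBases n).card : ℝ) ≤ ((additiveBases (n + 1)).card : ℝ)
  have hs0 : 0 < Real.sqrt 3 := by positivity
  have hsq : Real.sqrt 3 ^ 2 = 3 := Real.sq_sqrt (by norm_num)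
  have hs2 : Real.sqrt 3 ≤ 2 := by nlinarith
  have hs1 : 1 ≤ Real.sqrt 3 := by nlinarith
  rcases Nat.eq_zero_or_pos n with rfl | hn
  · refine (mul_nonpos_of_nonpos_of_nonneg ?_ (Nat.cast_nonneg _)).trans (Nat.cast_nonneg _)
    have : 2 ≤ 4 / Real.sqrt 3 := by
      rw [le_div_iff₀ hs0]
      linarith
    simpa using this
  have hgrowth : 2 * ((additiveBases n).card : ℝ) ≤ ((additiveBases (n + 1)).card : ℝ) +
      (((additiveBases n).filter (fun X => n + 1 ∉ X + X)).card : ℝ) := by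
    exact_mod_cast two_mul_card_additiveBases_le n
  have hmissing : (((additiveBases n).filter (fun X => n + 1 ∉ X + X)).card : ℝ) ≤
      Real.sqrt 3 ^ n := calc
    _ ≤ (3 : ℝ) ^ (n / 2) := by exact_mod_cast card_additiveBases_filter_notMem_le n
    _ = Real.sqrt 3 ^ (2 * (n / 2)) := by rw [pow_mul, hsq]
    _ ≤ Real.sqrt 3 ^ n := pow_le_pow_right₀ hs1 (by omega)
  have hlower : (2 : ℝ) ^ n ≤ 4 * n * ((additiveBases n).card : ℝ) := by
    exact_mod_cast two_pow_le_four_mul_card_additiveBases hn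
  have hn1 : (1 : ℝ) ≤ n := by exact_mod_cast hn
  have hpoly : Real.sqrt 3 * n ≤ ((n : ℝ) + 1) ^ 20 := calc
    Real.sqrt 3 * n ≤ ((n : ℝ) + 1) ^ 2 := by nlinarith
    _ ≤ ((n : ℝ) + 1) ^ 20 := pow_le_pow_right₀ (by linarith) (by norm_num)
  have hmain : Real.sqrt 3 ^ n ≤ 4 / Real.sqrt 3 * (Real.sqrt 3 / 2) ^ n * (n + 1) ^ 20 *
      ((additiveBases n).card : ℝ) := by
    calc Real.sqrt 3 ^ n = (Real.sqrt 3 / 2) ^ n * 2 ^ n := by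
          rw [← mul_pow, div_mul_cancel₀ _ two_ne_zero]
      _ ≤ (Real.sqrt 3 / 2) ^ n * (4 * n * ((additiveBases n).card : ℝ)) := by gcongr
      _ = 4 / Real.sqrt 3 * (Real.sqrt 3 / 2) ^ n * (Real.sqrt 3 * n) *
          ((additiveBases n).card : ℝ) := by
        field_simp
      _ ≤ _ := by gcongr
  linarith
end
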